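/- Let ζ ∈ ℂ be a primitive 5th root of unity. Let σ and τ act on points v ∈ ℂ^{ℤ/5} by (σv)_k = v_{k-1} and (τv)_k = ζ^k v_k. Let L = {v ∈ ℂ^{ℤ/5} : v_0 = 0, v_1 + v_4 = 0, v_2 + v_3 = 0}. Then for every nonzero v ∈ ℂ^{ℤ/5}, every H_5-invariant homogeneous quintic polynomial vanishes at v if and only if there exist i, j ∈ ℤ/5 with σ^i τ^j v ∈ L. In other words, the common zero locus of all H_5-invariant quintics in ℂ^5 ∖ {0} is the union of the 25 lines σ^i τ^j L, i, j ∈ ℤ/5. -/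

import Mathlib

open MvPolynomial

namespace HeisenbergQuintic

/-- The sum of the cyclic shifts of the monomial with exponents `m`. -/
noncomputable def orbitSum (m : ZMod 5 → ℕ) : MvPolynomial (ZMod 5) ℂ :=
  ∑ s, ∏ i, X (i + s) ^ m i

theorem orbitSum_mem {m : ZMod 5 → ℕ} (hm : ∑ i, m i = 5) :
    orbitSum m ∈ homogeneousSubmodule (ZMod 5) ℂ 5 := by
  rw [mem_homogeneousSubmodule]
  refine IsHomogeneous.sum _ _ _ fun s _ => ?_
  have h := IsHomogeneous.prod Finset.univ (fun i => (X (i + s) : MvPolynomial (ZMod 5) ℂ) ^ m i)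
    m fun i _ => by simpa using (isHomogeneous_X ℂ (i + s)).pow (m i)
  rwa [hm] at h

theorem rename_orbitSum (m : ZMod 5 → ℕ) :
    rename (fun i : ZMod 5 => i + 1) (orbitSum m) = orbitSum m := by
  simp only [orbitSum, map_sum, map_prod, map_pow, rename_X, add_assoc]
  exact Equiv.sum_comp (Equiv.addRight (1 : ZMod 5))
    fun s => ∏ i, (X (i + s) : MvPolynomial (ZMod 5) ℂ) ^ m i

theorem prod_pow_val_eq_one {ζ : ℂ} (hζ : ζ ^ 5 = 1) {m : ZMod 5 → ℕ} (f : ZMod 5 → ZMod 5)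
    (hm : ∑ i, f i * m i = 0) : ∏ i, (ζ ^ (f i).val) ^ m i = 1 := by
  simp only [← pow_mul, Finset.prod_pow_eq_pow_sum]
  have h : 5 ∣ ∑ i, (f i).val * m i := by
    rw [← ZMod.natCast_eq_zero_iff]
    simpa using hm
  obtain ⟨c, hc⟩ := h
  rw [hc, pow_mul, hζ, one_pow]

theorem aeval_orbitSum {ζ : ℂ} (hζ : ζ ^ 5 = 1) {m : ZMod 5 → ℕ} (hm : ∑ i, m i = 5)
    (hw : ∑ i, i * (m i : ZMod 5) = 0) :
    aeval (fun i : ZMod 5 => (ζ ^ i.val) • (X i : MvPolynomial (ZMod 5) ℂ)) (orbitSum m) =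
      orbitSum m := by
  simp only [orbitSum, map_sum, map_prod, map_pow, aeval_X, smul_pow]
  refine Finset.sum_congr rfl fun s _ => ?_
  have h : ∑ i, (i + s) * (m i : ZMod 5) = 0 := by
    simp only [add_mul, Finset.sum_add_distrib, hw, ← Finset.mul_sum, ← Nat.cast_sum, hm]
    simp [show (5 : ZMod 5) = 0 from rfl]
  rw [Finset.prod_smul, prod_pow_val_eq_one hζ (fun i => i + s) h, one_smul]

theorem eval_orbitSum (m : ZMod 5 → ℕ) (v : ZMod 5 → ℂ) :
    eval v (orbitSum m) = ∑ s, ∏ i, v (i + s) ^ m i := by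
  simp [orbitSum]

theorem eval_orbitSum_shift (m : ZMod 5 → ℕ) (v : ZMod 5 → ℂ) (s : ZMod 5) :
    eval (fun i => v (i + s)) (orbitSum m) = eval v (orbitSum m) := by
  simp only [eval_orbitSum, add_assoc]
  exact Equiv.sum_comp (Equiv.addRight s) fun t => ∏ i, v (i + t) ^ m i

/-- `v` lies on the translate of the line `L` with parameters `s` and `w`. -/
def OnLine (v : ZMod 5 → ℂ) (s : ZMod 5) (w : ℂ) : Prop :=
  w ^ 5 = 1 ∧ v s = 0 ∧ w * v (s + 1) + v (s + 4) = 0 ∧ w ^ 2 * v (s + 2) + v (s + 3) = 0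

theorem exists_root_of_pow_add_pow_eq_zero {x y : ℂ} (h : x ^ 5 + y ^ 5 = 0) :
    ∃ w : ℂ, w ^ 5 = 1 ∧ w * x + y = 0 := by
  by_cases hx : x = 0
  · subst hx
    have hy : y = 0 := by simpa using h
    exact ⟨1, by simp, by simp [hy]⟩
  · refine ⟨-y / x, ?_, by field_simp; ring⟩
    rw [div_pow, div_eq_one_iff_eq (pow_ne_zero _ hx)]
    linear_combination -h

theorem exists_onLine_of_distance_two {v : ZMod 5 → ℂ} (s : ZMod 5) (h0 : v s = 0)
    (h2 : v (s + 2) = 0) (h3 : v (s + 3) = 0) (h : v (s + 1) ^ 5 + v (s + 4) ^ 5 = 0) :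
    ∃ s w, OnLine v s w := by
  obtain ⟨w, hw, hw'⟩ := exists_root_of_pow_add_pow_eq_zero h
  exact ⟨s, w, hw, h0, hw', by simp [h2, h3]⟩

theorem exists_onLine_of_distance_one {v : ZMod 5 → ℂ} (s : ZMod 5) (h0 : v s = 0)
    (h1 : v (s + 1) = 0) (h4 : v (s + 4) = 0) (h : v (s + 2) ^ 5 + v (s + 3) ^ 5 = 0) :
    ∃ s w, OnLine v s w := by
  obtain ⟨w, hw, hw'⟩ := exists_root_of_pow_add_pow_eq_zero h
  refine ⟨s, w ^ 3, ?_, h0, by simp [h1, h4], ?_⟩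
  · rw [← pow_mul, mul_comm, pow_mul, hw, one_pow]
  · linear_combination hw' + w * v (s + 2) * hw

theorem exists_onLine_of_zero {v : ZMod 5 → ℂ} (h0 : v 0 = 0)
    (hA : v 1 ^ 5 + v 2 ^ 5 + v 3 ^ 5 + v 4 ^ 5 = 0)
    (hB : v 2 * v 3 * (v 1 * v 2 ^ 2 + v 3 ^ 2 * v 4) = 0)
    (hC : v 1 * v 4 * (v 1 ^ 2 * v 3 + v 2 * v 4 ^ 2) = 0)
    (hE : v 1 * v 4 * (v 1 * v 2 ^ 2 + v 3 ^ 2 * v 4) = 0) :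
    ∃ s w, OnLine v s w := by
  have e (a b c : ZMod 5) (h : a + b = c := by decide) : v (a + b) = v c := by rw [h]
  have d12 (h3 : v 3 = 0) (h4 : v 4 = 0) : ∃ s w, OnLine v s w := by
    refine exists_onLine_of_distance_one 4 h4 ?_ ?_ ?_
    · rw [e 4 1 0, h0]
    · rw [e 4 4 3, h3]
    · rw [e 4 2 1, e 4 3 2]
      simpa [h3, h4] using hA
  have d34 (h1 : v 1 = 0) (h2 : v 2 = 0) : ∃ s w, OnLine v s w := by
    refine exists_onLine_of_distance_one 1 h1 ?_ ?_ ?_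
    · rw [e 1 1 2, h2]
    · rw [e 1 4 0, h0]
    · rw [e 1 2 3, e 1 3 4]
      simpa [h1, h2] using hA
  have d13 (h2 : v 2 = 0) (h4 : v 4 = 0) : ∃ s w, OnLine v s w := by
    refine exists_onLine_of_distance_two 2 h2 ?_ ?_ ?_
    · rw [e 2 2 4, h4]
    · rw [e 2 3 0, h0]
    · rw [e 2 1 3, e 2 4 1]
      simpa [h2, h4, add_comm] using hA
  have d24 (h1 : v 1 = 0) (h3 : v 3 = 0) : ∃ s w, OnLine v s w := by
    refine exists_onLine_of_distance_two 3 h3 ?_ ?_ ?_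
    · rw [e 3 2 0, h0]
    · rw [e 3 3 1, h1]
    · rw [e 3 1 4, e 3 4 2]
      simpa [h1, h3, add_comm] using hA
  have d14 (h2 : v 2 = 0) (h3 : v 3 = 0) : ∃ s w, OnLine v s w :=
    exists_onLine_of_distance_two 0 h0 (by simpa using h2) (by simpa using h3)
      (by simpa [h2, h3] using hA)
  have d23 (h1 : v 1 = 0) (h4 : v 4 = 0) : ∃ s w, OnLine v s w :=
    exists_onLine_of_distance_one 0 h0 (by simpa using h1) (by simpa using h4)
      (by simpa [h1, h4] using hA)
  by_cases h1 : v 1 = 0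
  · by_cases h2 : v 2 = 0
    · exact d34 h1 h2
    by_cases h3 : v 3 = 0
    · exact d24 h1 h3
    exact d23 h1 (by simpa [h1, h2, h3] using hB)
  by_cases h4 : v 4 = 0
  · by_cases h2 : v 2 = 0
    · exact d13 h2 h4
    by_cases h3 : v 3 = 0
    · exact d12 h3 h4
    simp [h1, h2, h3, h4] at hB
  by_cases h2 : v 2 = 0
  · exact d14 h2 (by simpa [h1, h2, h4] using hC)
  by_cases h3 : v 3 = 0
  · simp [h1, h2, h3, h4] at hC
  have hP : v 1 * v 2 ^ 2 + v 3 ^ 2 * v 4 = 0 := by simpa [h1, h4] using hE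
  have hQ : v 1 ^ 2 * v 3 + v 2 * v 4 ^ 2 = 0 := by simpa [h1, h4] using hC
  have key : v 1 ^ 5 + v 4 ^ 5 = 0 := by
    have : v 3 ^ 2 * (v 1 ^ 5 + v 4 ^ 5) = 0 := by
      linear_combination v 1 * (v 1 ^ 2 * v 3 - v 2 * v 4 ^ 2) * hQ + v 4 ^ 4 * hP
    simpa [h3] using this
  obtain ⟨w, hw, hw'⟩ := exists_root_of_pow_add_pow_eq_zero key
  refine ⟨0, w, hw, h0, by simpa using hw', ?_⟩
  have h4' : v 4 = -(w * v 1) := by linear_combination hw'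
  rw [h4'] at hQ
  have : v 1 ^ 2 * (w ^ 2 * v 2 + v 3) = 0 := by linear_combination hQ
  simpa [h1] using this

/-- The exponents `a`, `b`, `c`, `d`, `e` indexed by `ℤ/5`. -/
def exponents (a b c d e : ℕ) : ZMod 5 → ℕ := ![a, b, c, d, e]

theorem exists_onLine_of_eval_orbitSum {v : ZMod 5 → ℂ}
    (h : ∀ m : ZMod 5 → ℕ, ∑ i, m i = 5 → ∑ i, i * (m i : ZMod 5) = 0 →
      eval v (orbitSum m) = 0) : ∃ s w, OnLine v s w := by
  obtain ⟨s, hs⟩ : ∃ s, v s = 0 := by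
    have h1 := h (fun _ => 1) (by decide) (by decide)
    have h2 (s : ZMod 5) : ∏ i, v (i + s) = ∏ i, v i := Equiv.prod_comp (Equiv.addRight s) v
    simp only [eval_orbitSum, pow_one, h2] at h1
    simpa [Finset.prod_eq_zero_iff] using h1
  obtain ⟨u, hu⟩ : ∃ u : ZMod 5 → ℂ, u = fun i => v (i + s) := ⟨_, rfl⟩
  have hu0 : u 0 = 0 := by simp [hu, hs]
  have expand (a b c d e : ℕ) (h1 : ∑ i, exponents a b c d e i = 5)
      (h2 : ∑ i, i * (exponents a b c d e i : ZMod 5) = 0) :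
      u 0 ^ a * u 1 ^ b * u 2 ^ c * u 3 ^ d * u 4 ^ e +
      u 1 ^ a * u 2 ^ b * u 3 ^ c * u 4 ^ d * u 0 ^ e +
      u 2 ^ a * u 3 ^ b * u 4 ^ c * u 0 ^ d * u 1 ^ e +
      u 3 ^ a * u 4 ^ b * u 0 ^ c * u 1 ^ d * u 2 ^ e +
      u 4 ^ a * u 0 ^ b * u 1 ^ c * u 2 ^ d * u 3 ^ e = 0 := by
    have h3 : eval u (orbitSum (exponents a b c d e)) = 0 := by
      rw [hu, eval_orbitSum_shift, h _ h1 h2]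
    rw [eval_orbitSum] at h3
    rw [← h3]
    symm
    refine (Fin.sum_univ_five _).trans ?_
    congr 1
    · congr 1
      · congr 1
        · congr 1
          · exact Fin.prod_univ_five _
          · exact Fin.prod_univ_five _
        · exact Fin.prod_univ_five _
      · exact Fin.prod_univ_five _
    · exact Fin.prod_univ_five _
  have line : ∃ t w, OnLine u t w := by
    have hA := expand 5 0 0 0 0 (by decide) (by decide)
    have hB := expand 3 1 0 0 1 (by decide) (by decide)
    have hC := expand 3 0 1 1 0 (by decide) (by decide)
    have hE := expand 1 0 2 2 0 (by decide) (by decide)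
    rw [hu0] at hA hB hC hE
    exact exists_onLine_of_zero hu0 (by linear_combination hA) (by linear_combination hB)
      (by linear_combination hC) (by linear_combination hE)
  obtain ⟨t, w, h1, h2, h3, h4⟩ := line
  simp only [hu] at h2 h3 h4
  refine ⟨t + s, w, h1, h2, ?_, ?_⟩
  · rwa [add_right_comm t s 1, add_right_comm t s 4]
  · rwa [add_right_comm t s 2, add_right_comm t s 3]

theorem coeff_aeval_smul_X (c : ZMod 5 → ℂ) (f : MvPolynomial (ZMod 5) ℂ) (m : ZMod 5 →₀ ℕ) :
    coeff m (aeval (fun i => c i • (X i : MvPolynomial (ZMod 5) ℂ)) f) =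
      (∏ i, c i ^ m i) * coeff m f := by
  induction f using MvPolynomial.induction_on' with
  | monomial d a =>
    have : aeval (fun i => c i • (X i : MvPolynomial (ZMod 5) ℂ)) (monomial d a) =
        (∏ i, c i ^ d i) • monomial d a := by
      rw [aeval_monomial, Finsupp.prod_fintype _ _ (by simp), monomial_eq,
        Finsupp.prod_fintype _ _ (by simp)]
      simp only [smul_pow, Finset.prod_smul, algebraMap_eq, mul_smul_comm]
    rw [this, coeff_smul, coeff_monomial, smul_eq_mul]
    split_ifs with h
    · rw [h]
    · simp
  | add p q hp hq => simp only [map_add, coeff_add, hp, hq, mul_add]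

theorem eval_aeval_smul_X (c u : ZMod 5 → ℂ) (f : MvPolynomial (ZMod 5) ℂ) :
    eval u (aeval (fun i => c i • (X i : MvPolynomial (ZMod 5) ℂ)) f) =
      eval (fun i => c i * u i) f := by
  induction f using MvPolynomial.induction_on with
  | C a => simp
  | add p q hp hq => simp only [map_add, hp, hq]
  | mul_X p i hp => rw [map_mul, map_mul, hp, map_mul, aeval_X, smul_eval, eval_X, eval_X]

theorem coeff_rename_equiv (e : ZMod 5 ≃ ZMod 5) (f : MvPolynomial (ZMod 5) ℂ)
    (m : ZMod 5 →₀ ℕ) : coeff m (rename e f) = coeff (Finsupp.equivMapDomain e.symm m) f := by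
  have h : m = Finsupp.mapDomain e (Finsupp.equivMapDomain e.symm m) := by
    rw [← Finsupp.equivMapDomain_eq_mapDomain]
    ext i
    simp
  conv_lhs => rw [h]
  exact coeff_rename_mapDomain e e.injective f _

/-- A weight-zero quintic monomial has a cyclic shift equal to its reflection. -/
theorem exists_shift_eq_reflection (m : ZMod 5 → ℕ) (hm : ∑ i, m i = 5)
    (hw : ∑ i, i * (m i : ZMod 5) = 0) : ∃ s, ∀ i, m (-i) = m (i + s) := by
  have key : ∀ m ∈ Finset.Nat.antidiagonalTuple 5 5,
      ∑ i : ZMod 5, i * ((show ZMod 5 → ℕ from m) i : ZMod 5) = 0 →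
      ∃ s : ZMod 5, ∀ i : ZMod 5,
        (show ZMod 5 → ℕ from m) (-i) = (show ZMod 5 → ℕ from m) (i + s) := by
    decide +kernel
  exact key m (Finset.Nat.mem_antidiagonalTuple.2 hm) hw

theorem rename_shift_eq_self {f : MvPolynomial (ZMod 5) ℂ}
    (h : rename (fun i : ZMod 5 => i + 1) f = f) (s : ZMod 5) :
    rename (Equiv.addRight s) f = f := by
  have key (n : ℕ) : rename (fun i : ZMod 5 => i + n) f = f := by
    induction n with
    | zero => simp [show (fun i : ZMod 5 => i) = id from rfl]
    | succ n ih =>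
      conv_rhs => rw [← h, ← ih, rename_rename]
      congr 2
      funext i
      simp [add_assoc]
  simpa using key s.val

theorem sum_eq_zero_of_prod_pow_val_eq_one {ζ : ℂ} (hζ : IsPrimitiveRoot ζ 5) {m : ZMod 5 → ℕ}
    (h : ∏ i : ZMod 5, (ζ ^ i.val) ^ m i = 1) : ∑ i, i * (m i : ZMod 5) = 0 := by
  simp only [← pow_mul, Finset.prod_pow_eq_pow_sum] at h
  have h' := (ZMod.natCast_eq_zero_iff _ 5).2 (hζ.dvd_of_pow_eq_one _ h)
  simpa using h'

/-- An `H₅`-invariant quintic is invariant under the reflection of the indices. -/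
theorem rename_neg_eq_self {ζ : ℂ} (hζ : IsPrimitiveRoot ζ 5) {f : MvPolynomial (ZMod 5) ℂ}
    (hf : f.IsHomogeneous 5) (hσ : rename (fun i : ZMod 5 => i + 1) f = f)
    (hτ : aeval (fun i : ZMod 5 => (ζ ^ i.val) • (X i : MvPolynomial (ZMod 5) ℂ)) f = f) :
    rename (Equiv.neg (ZMod 5)) f = f := by
  have reflection {m : ZMod 5 →₀ ℕ} (hm : coeff m f ≠ 0) : ∃ s, ∀ i, m (-i) = m (i + s) := by
    refine exists_shift_eq_reflection m ?_ (sum_eq_zero_of_prod_pow_val_eq_one hζ ?_)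
    · rw [← Finsupp.degree_eq_sum]
      by_contra h
      exact hm (hf.coeff_eq_zero h)
    · have h := coeff_aeval_smul_X (fun i => ζ ^ i.val) f m
      rw [hτ] at h
      exact mul_right_cancel₀ hm (by rw [← h, one_mul])
  ext m
  rw [coeff_rename_equiv]
  set n := Finsupp.equivMapDomain (Equiv.neg (ZMod 5)).symm m with hn
  have hn' (i : ZMod 5) : n i = m (-i) := rfl
  by_cases h : ∃ s, ∀ i, m (-i) = m (i + s)
  · obtain ⟨s, hs⟩ := h
    conv_rhs => rw [← rename_shift_eq_self hσ s, coeff_rename_equiv]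
    congr 1
    ext i
    exact hs i
  · have hm0 : coeff m f = 0 := by
      by_contra hm
      exact h (reflection hm)
    have hn0 : coeff n f = 0 := by
      by_contra hm
      obtain ⟨s, hs⟩ := reflection hm
      refine h ⟨-s, fun i => ?_⟩
      have hi := hs (-i)
      simp only [hn'] at hi
      simpa [add_comm] using hi
    rw [hm0, hn0]

theorem eval_eq_zero_of_rename_neg {f : MvPolynomial (ZMod 5) ℂ} (hf : f.IsHomogeneous 5)
    (hneg : rename (Equiv.neg (ZMod 5)) f = f) {u : ZMod 5 → ℂ} (h0 : u 0 = 0)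
    (h1 : u 1 + u 4 = 0) (h2 : u 2 + u 3 = 0) : eval u f = 0 := by
  have hu : u ∘ Equiv.neg (ZMod 5) = (-1 : ℂ) • u := by
    funext i
    fin_cases i
    · change u 0 = -1 * u 0
      rw [h0, mul_zero]
    · change u 4 = -1 * u 1
      linear_combination h1
    · change u 3 = -1 * u 2
      linear_combination h2
    · change u 2 = -1 * u 3
      linear_combination h2
    · change u 1 = -1 * u 4
      linear_combination h1
  have h : eval u f = eval ((-1 : ℂ) • u) f := by
    rw [← hu, ← eval_rename, hneg]
  have h' : eval ((-1 : ℂ) • u) f = (-1) ^ 5 * eval u f := by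
    rw [eval_eq', eval_eq', Finset.mul_sum]
    refine Finset.sum_congr rfl fun d hd => ?_
    have hd' : d.degree = 5 := by
      by_contra hne
      exact mem_support_iff.1 hd (hf.coeff_eq_zero hne)
    rw [Finsupp.degree_eq_sum] at hd'
    simp only [Pi.smul_apply, smul_eq_mul, mul_pow, Finset.prod_mul_distrib,
      Finset.prod_pow_eq_pow_sum, hd']
    ring
  rw [h'] at h
  linear_combination h / 2

theorem pow_eq_pow_of_cast_eq {ζ : ℂ} (hζ : ζ ^ 5 = 1) {a b : ℕ} (h : (a : ZMod 5) = b) :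
    ζ ^ a = ζ ^ b := by
  rw [ZMod.natCast_eq_natCast_iff'] at h
  rw [← Nat.div_add_mod a 5, ← Nat.div_add_mod b 5, h]
  simp [pow_add, pow_mul, hζ]

theorem exists_translate_of_onLine {ζ : ℂ} (hζ : IsPrimitiveRoot ζ 5) {v : ZMod 5 → ℂ}
    {s : ZMod 5} {w : ℂ} (h : OnLine v s w) :
    ∃ n : ZMod 5, v s = 0 ∧
      ζ ^ (n.val * (1 + s).val) * v (1 + s) + ζ ^ (n.val * (4 + s).val) * v (4 + s) = 0 ∧
      ζ ^ (n.val * (2 + s).val) * v (2 + s) + ζ ^ (n.val * (3 + s).val) * v (3 + s) = 0 := by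
  obtain ⟨hw, h0, h1, h2⟩ := h
  obtain ⟨k, -, rfl⟩ := hζ.eq_pow_of_pow_eq_one hw
  have five : (5 : ZMod 5) = 0 := rfl
  refine ⟨3 * k, h0, ?_, ?_⟩
  · have e : ζ ^ ((3 * k : ZMod 5).val * (1 + s).val) =
        ζ ^ ((3 * k : ZMod 5).val * (4 + s).val + k) := by
      apply pow_eq_pow_of_cast_eq hζ.pow_eq_one
      simp only [Nat.cast_mul, Nat.cast_add, ZMod.natCast_val, ZMod.cast_id', id_eq]
      linear_combination (-2 * k : ZMod 5) * five
    rw [e, pow_add, add_comm 1 s, add_comm 4 s]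
    linear_combination ζ ^ ((3 * k : ZMod 5).val * (s + 4).val) * h1
  · have e : ζ ^ ((3 * k : ZMod 5).val * (2 + s).val) =
        ζ ^ ((3 * k : ZMod 5).val * (3 + s).val + k * 2) := by
      apply pow_eq_pow_of_cast_eq hζ.pow_eq_one
      simp only [Nat.cast_mul, Nat.cast_add, ZMod.natCast_val, ZMod.cast_id', id_eq]
      push_cast
      linear_combination (-k : ZMod 5) * five
    rw [e, pow_add, pow_mul, add_comm 2 s, add_comm 3 s]
    linear_combination ζ ^ ((3 * k : ZMod 5).val * (s + 3).val) * h2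

end HeisenbergQuintic

open HeisenbergQuintic in
/-- For a nonzero vector `v ∈ ℂ^{ℤ/5}`, every H₅-invariant homogeneous quintic
polynomial vanishes at `v` iff some Heisenberg translate `σ^i τ^j v` lies in the line
`L = {v : v₀ = 0, v₁ + v₄ = 0, v₂ + v₃ = 0}`; i.e. the common zero locus of the H₅-invariant
quintics in `ℂ⁵ ∖ {0}` is the union of the 25 lines `σ^i τ^j L`. -/
theorem stmt_4 (ζ : ℂ) (hζ : IsPrimitiveRoot ζ 5)
    -- the substitutions on polynomials
    (σ τ : MvPolynomial (ZMod 5) ℂ →ₐ[ℂ] MvPolynomial (ZMod 5) ℂ)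
    (hσ : σ = rename (fun i : ZMod 5 => i + 1))
    (hτ : τ = aeval (fun i : ZMod 5 => (ζ ^ i.val) • X i))
    -- the corresponding linear actions on the point space ℂ^{ℤ/5}
    (σp τp : (ZMod 5 → ℂ) → (ZMod 5 → ℂ))
    (hσp : ∀ (v : ZMod 5 → ℂ) (k : ZMod 5), σp v k = v (k - 1))
    (hτp : ∀ (v : ZMod 5 → ℂ) (k : ZMod 5), τp v k = ζ ^ k.val * v k)
    (v : ZMod 5 → ℂ) (hv : v ≠ 0) :
    (∀ f ∈ homogeneousSubmodule (ZMod 5) ℂ 5, σ f = f → τ f = f → eval v f = 0) ↔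
      ∃ i j : ZMod 5,
        (σp^[i.val] (τp^[j.val] v)) 0 = 0 ∧
        (σp^[i.val] (τp^[j.val] v)) 1 + (σp^[i.val] (τp^[j.val] v)) 4 = 0 ∧
        (σp^[i.val] (τp^[j.val] v)) 2 + (σp^[i.val] (τp^[j.val] v)) 3 = 0 := by
  subst hσ hτ
  have hσn (n : ℕ) (u : ZMod 5 → ℂ) (k : ZMod 5) : σp^[n] u k = u (k - n) := by
    induction n generalizing k with
    | zero => simp
    | succ n ih =>
      rw [Function.iterate_succ_apply', hσp, ih, sub_sub, Nat.cast_succ, add_comm]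
  have hτn (n : ℕ) (u : ZMod 5 → ℂ) (k : ZMod 5) : τp^[n] u k = ζ ^ (n * k.val) * u k := by
    induction n with
    | zero => simp
    | succ n ih =>
      rw [Function.iterate_succ_apply', hτp, ih]
      ring
  constructor
  · intro h
    obtain ⟨s, w, hsw⟩ := exists_onLine_of_eval_orbitSum fun m hm hw =>
      h _ (orbitSum_mem hm) (rename_orbitSum m) (aeval_orbitSum hζ.pow_eq_one hm hw)
    obtain ⟨n, h0, h1, h2⟩ := exists_translate_of_onLine hζ hsw
    refine ⟨-s, n, ?_⟩
    simp only [hσn, hτn, ZMod.natCast_val, ZMod.cast_id', id_eq, sub_neg_eq_add, zero_add]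
    exact ⟨by rw [h0, mul_zero], h1, h2⟩
  · rintro ⟨i, j, h0, h1, h2⟩ f hf hσf hτf
    rw [mem_homogeneousSubmodule] at hf
    have hσe (n : ℕ) (u : ZMod 5 → ℂ) : eval (σp^[n] u) f = eval u f := by
      induction n with
      | zero => rfl
      | succ n ih =>
        rw [Function.iterate_succ_apply', ← ih]
        conv_lhs => rw [← hσf, eval_rename]
        congr 2
        funext k
        simp [hσp]
    have hτe (n : ℕ) (u : ZMod 5 → ℂ) : eval (τp^[n] u) f = eval u f := by
      induction n with
      | zero => rfl
      | succ n ih =>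
        rw [Function.iterate_succ_apply', ← ih]
        conv_rhs => rw [← hτf, eval_aeval_smul_X]
        congr 2
        funext k
        exact hτp _ k
    have h := eval_eq_zero_of_rename_neg hf (rename_neg_eq_self hζ hf hσf hτf) h0 h1 h2
    rwa [hσe, hτe] at h
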